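/- (Lemma 1 of the paper.) Let $m > 0$, let $J$ be a symmetric positive-definite $3\times 3$ real matrix, and let positive gains $k_{tp}, k_{td}, k_{rp}, k_{rd}, k_{pi}, k_{ri}, \sigma_1, \sigma_2, c_1, c_2$ satisfy $c_1 < \min(\sqrt{k_{tp}},\, \tfrac{4 k_{tp} k_{td}}{k_{td}^2 + 4 k_{tp}})$, $c_2 < \min(\sqrt{k_{rp}\lambda_{\min}(J)},\, \tfrac{4 \lambda_{\min}(J)^2 k_{rp} k_{rd}}{4 k_{rp}\lambda_{\min}(J)^2 + k_{rd}^2 \lambda_{\max}(J)})$, $k_{pi}\sigma_1 > \|\Delta_p\|_\infty$, and $k_{ri}\sigma_2 > \|\Delta_R\|_\infty$, where $\Delta_p, \Delta_R \in \mathbb{R}^3$ are constant vectors. Let $e_p, e_v, e_\omega, e_{pi}, e_{ri} \in \mathbb{R}^3$, $e_\mu \in \mathbb{R}^6$, and $R, R_d \in SO(3)$ with $\Psi := \tfrac{1}{2}\operatorname{tr}(I_3 - R_d^\top R) \le \psi_2 < 2$, and set $e_R = \tfrac{1}{2}(R_d^\top R - R^\top R_d)^\vee$. Define $V_1 = \tfrac{1}{2}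 k_{tp}\|e_p\|^2 + \tfrac{1}{2}\|e_v\|^2 + c_1 e_p^\top e_v + \int_{\Delta_p/k_{pi}}^{e_{pi}} (k_{pi}\,\mathrm{sat}_{\sigma_1}(\gamma) - \Delta_p)\cdot d\gamma$ (componentwise integral), $V_2 = \tfrac{1}{2} e_\omega^\top J e_\omega + k_{rp}\Psi + c_2 e_R^\top e_\omega + \int_{\Delta_R/k_{ri}}^{e_{ri}} (k_{ri}\,\mathrm{sat}_{\sigma_2}(\gamma) - \Delta_R)\cdot d\gamma$, and $V = \tfrac{1}{2} e_\mu^\top e_\mu + V_1 + V_2$. Then, with $z_1 = (\|e_p\|,\|e_v\|)^\top$, $z_2 = (\|e_R\|,\|e_\omega\|)^\top$, and $V_I$ denoting the sum of the two integral terms, the bounds $\tfrac{1}{2} e_\mu^\top e_\mu + z_1^\top M_{11} z_1 + z_2^\top M_{21} z_2 + V_I \le V \le \tfrac{1}{2} e_\mu^\top e_\mu + z_1^\top M_{12} z_1 + z_2^\top M_{22} z_2 + V_I$ hold, the four $2\times 2$ matrices $M_{11} = \tfrac{1}{2}\begin{pmatrix} k_{tp} & -c_1 \\ -c_1 & 1\end{pmatrix}$,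 $M_{12} = \tfrac{1}{2}\begin{pmatrix} k_{tp} & c_1 \\ c_1 & 1\end{pmatrix}$, $M_{21} = \tfrac{1}{2}\begin{pmatrix} k_{rp} & -c_2 \\ -c_2 & \lambda_{\min}(J)\end{pmatrix}$, $M_{22} = \tfrac{1}{2}\begin{pmatrix} \tfrac{2k_{rp}}{2-\psi_2} & c_2 \\ c_2 & \lambda_{\max}(J)\end{pmatrix}$ are positive definite, and $V_I \ge 0$ with $V_I = 0$ if and only if $k_{pi} e_{pi} = \Delta_p$ and $k_{ri} e_{ri} = \Delta_R$. -/

import Mathlib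

open Matrix

/-- Euclidean norm of a vector in `ℝ³`. -/
noncomputable def norm3 (v : Fin 3 → ℝ) : ℝ := Real.sqrt (v ⬝ᵥ v)

/-- The saturation function. -/
noncomputable def sat (σ y : ℝ) : ℝ := if |y| > σ then σ * Real.sign y else y

/-- The inverse of the hat map. -/
def vee (A : Matrix (Fin 3) (Fin 3) ℝ) : Fin 3 → ℝ := ![A 2 1, A 0 2, A 1 0]

/-- Membership in `SO(3)`: orthogonal with determinant one. -/
def SO3 (Q : Matrix (Fin 3) (Fin 3) ℝ) : Prop := Qᵀ * Q = 1 ∧ Q.det = 1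

theorem sat_eq_max_min {σ : ℝ} (hσ : 0 < σ) (y : ℝ) : sat σ y = max (-σ) (min σ y) := by
  unfold sat
  split_ifs with h
  · rcases lt_abs.mp h with h | h
    · rw [Real.sign_of_pos (hσ.trans h), min_eq_left h.le, max_eq_right (by linarith), mul_one]
    · rw [Real.sign_of_neg (by linarith), min_eq_right (by linarith),
        max_eq_left (by linarith), mul_neg_one]
  · obtain ⟨h₁, h₂⟩ := abs_le.mp (not_lt.mp h)
    rw [min_eq_right h₂, max_eq_right h₁]

theorem continuous_sat {σ : ℝ} (hσ : 0 < σ) : Continuous (sat σ) := by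
  rw [funext (sat_eq_max_min hσ)]
  fun_prop

theorem lt_mul_sat {k σ d y : ℝ} (hk : 0 < k) (hσ : 0 < σ) (hd : |d| < k * σ) (hy : d / k < y) :
    d < k * sat σ y := by
  have hdσ : d / k < σ := by
    rw [div_lt_iff₀' hk]
    exact (le_abs_self d).trans_lt hd
  rw [← div_lt_iff₀' hk, sat_eq_max_min hσ]
  exact lt_max_of_lt_right (lt_min hdσ hy)

theorem mul_sat_lt {k σ d y : ℝ} (hk : 0 < k) (hσ : 0 < σ) (hd : |d| < k * σ) (hy : y < d / k) :
    k * sat σ y < d := by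
  have hdσ : -σ < d / k := by
    rw [lt_div_iff₀' hk]
    linarith [neg_abs_le d]
  rw [← lt_div_iff₀' hk, sat_eq_max_min hσ]
  exact max_lt hdσ (min_lt_of_right_lt hy)

theorem integral_mul_sat_sub_pos {k σ d e : ℝ} (hk : 0 < k) (hσ : 0 < σ) (hd : |d| < k * σ)
    (he : e ≠ d / k) : 0 < ∫ γ in (d / k)..e, (k * sat σ γ - d) := by
  have hc : Continuous fun γ => k * sat σ γ - d :=
    ((continuous_sat hσ).const_mul k).sub continuous_const
  rcases he.lt_or_gt with h | h
  · rw [intervalIntegral.integral_symm, ← intervalIntegral.integral_neg]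
    exact intervalIntegral.intervalIntegral_pos_of_pos_on (hc.neg.intervalIntegrable _ _)
      (fun x hx => by linarith [mul_sat_lt hk hσ hd hx.2]) h
  · exact intervalIntegral.intervalIntegral_pos_of_pos_on (hc.intervalIntegrable _ _)
      (fun x hx => by linarith [lt_mul_sat hk hσ hd hx.1]) h

theorem integral_mul_sat_sub_nonneg {k σ d : ℝ} (hk : 0 < k) (hσ : 0 < σ) (hd : |d| < k * σ)
    (e : ℝ) : 0 ≤ ∫ γ in (d / k)..e, (k * sat σ γ - d) := by
  rcases eq_or_ne e (d / k) with rfl | he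
  · simp
  · exact (integral_mul_sat_sub_pos hk hσ hd he).le

theorem integral_mul_sat_sub_eq_zero_iff {k σ d e : ℝ} (hk : 0 < k) (hσ : 0 < σ)
    (hd : |d| < k * σ) : ∫ γ in (d / k)..e, (k * sat σ γ - d) = 0 ↔ k * e = d := by
  rw [mul_comm k, ← eq_div_iff hk.ne']
  refine ⟨fun h => ?_, fun h => by simp [h]⟩
  by_contra he
  exact (integral_mul_sat_sub_pos hk hσ hd he).ne' h

theorem sum_integral_mul_sat_sub_eq_zero_iff {ι : Type*} [Fintype ι] {k σ : ℝ} {d e : ι → ℝ}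
    (hk : 0 < k) (hσ : 0 < σ) (hd : ∀ i, |d i| < k * σ) :
    ∑ i, ∫ γ in (d i / k)..(e i), (k * sat σ γ - d i) = 0 ↔ k • e = d := by
  rw [Finset.sum_eq_zero_iff_of_nonneg fun i _ => integral_mul_sat_sub_nonneg hk hσ (hd i) (e i)]
  simp [integral_mul_sat_sub_eq_zero_iff hk hσ (hd _), funext_iff]

theorem norm3_nonneg (v : Fin 3 → ℝ) : 0 ≤ norm3 v := Real.sqrt_nonneg _

theorem norm3_sq (v : Fin 3 → ℝ) : norm3 v ^ 2 = v ⬝ᵥ v :=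
  Real.sq_sqrt (Finset.sum_nonneg fun i _ => mul_self_nonneg (v i))

theorem abs_dotProduct_le_norm3_mul (v w : Fin 3 → ℝ) : |v ⬝ᵥ w| ≤ norm3 v * norm3 w := by
  refine abs_le_of_sq_le_sq ?_ (mul_nonneg (norm3_nonneg v) (norm3_nonneg w))
  rw [mul_pow, norm3_sq, norm3_sq]
  simpa only [dotProduct, ← pow_two] using Finset.sum_mul_sq_le_sq_mul_sq Finset.univ v w

theorem SO3.transpose_mul {P Q : Matrix (Fin 3) (Fin 3) ℝ} (hP : SO3 P) (hQ : SO3 Q) :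
    SO3 (Pᵀ * Q) := by
  refine ⟨?_, by rw [det_mul, det_transpose, hP.2, hQ.2, one_mul]⟩
  have hP' : P * Pᵀ = 1 := mul_eq_one_comm.mp hP.1
  rw [Matrix.transpose_mul, transpose_transpose, Matrix.mul_assoc, ← Matrix.mul_assoc P, hP',
    Matrix.one_mul, hQ.1]

theorem SO3.adjugate_eq_transpose {Q : Matrix (Fin 3) (Fin 3) ℝ} (hQ : SO3 Q) :
    Q.adjugate = Qᵀ := by
  calc Q.adjugate = (Qᵀ * Q) * Q.adjugate := by rw [hQ.1, Matrix.one_mul]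
    _ = Qᵀ := by rw [Matrix.mul_assoc, mul_adjugate, hQ.2, one_smul, Matrix.mul_one]

theorem SO3.trace_one_sub_nonneg {Q : Matrix (Fin 3) (Fin 3) ℝ} (hQ : SO3 Q) :
    0 ≤ (1 / 2) * trace ((1 : Matrix (Fin 3) (Fin 3) ℝ) - Q) := by
  have h := fun i => congrFun (congrFun hQ.1 i) i
  have h0 := h 0
  have h1 := h 1
  have h2 := h 2
  simp [mul_apply, Fin.sum_univ_three] at h0 h1 h2
  simp [trace, Fin.sum_univ_three]
  have : Q 0 0 ≤ 1 := by nlinarith [sq_nonneg (Q 1 0), sq_nonneg (Q 2 0)]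
  have : Q 1 1 ≤ 1 := by nlinarith [sq_nonneg (Q 0 1), sq_nonneg (Q 2 1)]
  have : Q 2 2 ≤ 1 := by nlinarith [sq_nonneg (Q 0 2), sq_nonneg (Q 1 2)]
  linarith

theorem SO3.norm3_vee_sq {Q : Matrix (Fin 3) (Fin 3) ℝ} (hQ : SO3 Q) {Ψ : ℝ}
    (hΨ : Ψ = (1 / 2) * trace ((1 : Matrix (Fin 3) (Fin 3) ℝ) - Q)) :
    norm3 ((1 / 2 : ℝ) • vee (Q - Qᵀ)) ^ 2 = Ψ * (2 - Ψ) := by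
  have h := fun i => congrFun (congrFun hQ.1 i) i
  have h0 := h 0
  have h1 := h 1
  have h2 := h 2
  have a := fun i => congrFun (congrFun hQ.adjugate_eq_transpose i) i
  have a0 := a 0
  have a1 := a 1
  have a2 := a 2
  simp [mul_apply, Fin.sum_univ_three] at h0 h1 h2
  simp [adjugate_fin_three] at a0 a1 a2
  rw [norm3_sq, hΨ]
  simp [vee, dotProduct, trace, Fin.sum_univ_three]
  linear_combination (1 / 4) * (h0 + h1 + h2) + (1 / 2) * (a0 + a1 + a2)

theorem dotProduct_half_smul_mulVec (a b c : ℝ) (z : Fin 2 → ℝ) :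
    z ⬝ᵥ ((1 / 2 : ℝ) • !![a, b; b, c]).mulVec z =
      (1 / 2) * (a * z 0 ^ 2 + 2 * b * (z 0 * z 1) + c * z 1 ^ 2) := by
  simp [dotProduct, mulVec, Fin.sum_univ_two]
  ring

theorem dotProduct_half_smul_mulVec_pos {a b c : ℝ} (ha : 0 < a) (h : b ^ 2 < a * c)
    {z : Fin 2 → ℝ} (hz : z ≠ 0) :
    0 < z ⬝ᵥ ((1 / 2 : ℝ) • !![a, b; b, c]).mulVec z := by
  rw [dotProduct_half_smul_mulVec]
  have key : 0 < (a * z 0 + b * z 1) ^ 2 + (a * c - b ^ 2) * z 1 ^ 2 := by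
    by_cases h1 : z 1 = 0
    · have h0 : z 0 ≠ 0 := fun h0 => hz (by ext i; fin_cases i <;> simp [h0, h1])
      rw [h1]
      have : 0 < (a * z 0) ^ 2 := by positivity
      linarith
    · have : 0 < (a * c - b ^ 2) * z 1 ^ 2 := mul_pos (sub_pos.mpr h) (by positivity)
      linarith [sq_nonneg (a * z 0 + b * z 1)]
  have : 0 < a * (a * z 0 ^ 2 + 2 * b * (z 0 * z 1) + c * z 1 ^ 2) := by linarith
  have := pos_of_mul_pos_right this ha.le
  linarith

theorem stmt5 (m : ℝ) (hm : 0 < m)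
    (J : Matrix (Fin 3) (Fin 3) ℝ) (hJsym : J.IsSymm)
    (hJpd : ∀ v : Fin 3 → ℝ, v ≠ 0 → 0 < v ⬝ᵥ J.mulVec v)
    (lmin lmax : ℝ)
    -- `lmin` is the smallest eigenvalue of `J`
    (hlmin_le : ∀ v : Fin 3 → ℝ, lmin * (v ⬝ᵥ v) ≤ v ⬝ᵥ J.mulVec v)
    (hlmin_eig : ∃ v : Fin 3 → ℝ, v ≠ 0 ∧ J.mulVec v = lmin • v)
    -- `lmax` is the largest eigenvalue of `J`
    (hlmax_ge : ∀ v : Fin 3 → ℝ, v ⬝ᵥ J.mulVec v ≤ lmax * (v ⬝ᵥ v))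
    (hlmax_eig : ∃ v : Fin 3 → ℝ, v ≠ 0 ∧ J.mulVec v = lmax • v)
    (ktp ktd krp krd kpi kri σ1 σ2 c1 c2 : ℝ)
    (hktp : 0 < ktp) (hktd : 0 < ktd) (hkrp : 0 < krp) (hkrd : 0 < krd)
    (hkpi : 0 < kpi) (hkri : 0 < kri) (hσ1 : 0 < σ1) (hσ2 : 0 < σ2)
    (hc1pos : 0 < c1) (hc2pos : 0 < c2)
    (hc1 : c1 < min (Real.sqrt ktp) (4 * ktp * ktd / (ktd ^ 2 + 4 * ktp)))
    (hc2 : c2 < min (Real.sqrt (krp * lmin))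
      (4 * lmin ^ 2 * krp * krd / (4 * krp * lmin ^ 2 + krd ^ 2 * lmax)))
    (Δp ΔR : Fin 3 → ℝ)
    -- `kpi * σ1 > ‖Δp‖∞` and `kri * σ2 > ‖ΔR‖∞`
    (hΔp : ∀ i, |Δp i| < kpi * σ1) (hΔR : ∀ i, |ΔR i| < kri * σ2)
    (ep ev eω epi eri : Fin 3 → ℝ) (eμ : Fin 6 → ℝ)
    (R Rd : Matrix (Fin 3) (Fin 3) ℝ) (hR : SO3 R) (hRd : SO3 Rd)
    (ψ2 : ℝ) (hψ2 : ψ2 < 2)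
    (hΨ : (1/2) * Matrix.trace ((1 : Matrix (Fin 3) (Fin 3) ℝ) - Rdᵀ * R) ≤ ψ2) :
    let Ψ : ℝ := (1/2) * Matrix.trace ((1 : Matrix (Fin 3) (Fin 3) ℝ) - Rdᵀ * R)
    let eR : Fin 3 → ℝ := (1/2 : ℝ) • vee (Rdᵀ * R - Rᵀ * Rd)
    let VIp : ℝ := ∑ i, ∫ γ in (Δp i / kpi)..(epi i), (kpi * sat σ1 γ - Δp i)
    let VIR : ℝ := ∑ i, ∫ γ in (ΔR i / kri)..(eri i), (kri * sat σ2 γ - ΔR i)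
    let V1 : ℝ := (1/2) * ktp * norm3 ep ^ 2 + (1/2) * norm3 ev ^ 2
      + c1 * (ep ⬝ᵥ ev) + VIp
    let V2 : ℝ := (1/2) * (eω ⬝ᵥ J.mulVec eω) + krp * Ψ + c2 * (eR ⬝ᵥ eω) + VIR
    let V : ℝ := (1/2) * (eμ ⬝ᵥ eμ) + V1 + V2
    let VI : ℝ := VIp + VIR
    let z1 : Fin 2 → ℝ := ![norm3 ep, norm3 ev]
    let z2 : Fin 2 → ℝ := ![norm3 eR, norm3 eω]
    let M11 : Matrix (Fin 2) (Fin 2) ℝ := (1/2 : ℝ) • !![ktp, -c1; -c1, 1]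
    let M12 : Matrix (Fin 2) (Fin 2) ℝ := (1/2 : ℝ) • !![ktp, c1; c1, 1]
    let M21 : Matrix (Fin 2) (Fin 2) ℝ := (1/2 : ℝ) • !![krp, -c2; -c2, lmin]
    let M22 : Matrix (Fin 2) (Fin 2) ℝ := (1/2 : ℝ) • !![2 * krp / (2 - ψ2), c2; c2, lmax]
    ((1/2) * (eμ ⬝ᵥ eμ) + z1 ⬝ᵥ M11.mulVec z1 + z2 ⬝ᵥ M21.mulVec z2 + VI ≤ V ∧
      V ≤ (1/2) * (eμ ⬝ᵥ eμ) + z1 ⬝ᵥ M12.mulVec z1 + z2 ⬝ᵥ M22.mulVec z2 + VI) ∧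
    (∀ z : Fin 2 → ℝ, z ≠ 0 → 0 < z ⬝ᵥ M11.mulVec z) ∧
    (∀ z : Fin 2 → ℝ, z ≠ 0 → 0 < z ⬝ᵥ M12.mulVec z) ∧
    (∀ z : Fin 2 → ℝ, z ≠ 0 → 0 < z ⬝ᵥ M21.mulVec z) ∧
    (∀ z : Fin 2 → ℝ, z ≠ 0 → 0 < z ⬝ᵥ M22.mulVec z) ∧
    0 ≤ VI ∧ (VI = 0 ↔ (kpi • epi = Δp ∧ kri • eri = ΔR)) := by
  intro Ψ eR VIp VIR V1 V2 V VI z1 z2 M11 M12 M21 M22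
  have hQ : SO3 (Rdᵀ * R) := hRd.transpose_mul hR
  have hΨ0 : 0 ≤ Ψ := hQ.trace_one_sub_nonneg
  have heR : norm3 eR ^ 2 = Ψ * (2 - Ψ) := by
    have h := hQ.norm3_vee_sq (Ψ := Ψ) rfl
    rwa [Matrix.transpose_mul, transpose_transpose] at h
  have hΨψ : Ψ ≤ ψ2 := hΨ
  have hψ : 0 < 2 - ψ2 := by linarith
  have hlmin : 0 < lmin := by
    obtain ⟨v, hv, hJv⟩ := hlmin_eig
    have h := hJpd v hv
    rw [hJv, dotProduct_smul, smul_eq_mul] at h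
    exact pos_of_mul_pos_left h (Finset.sum_nonneg fun i _ => mul_self_nonneg (v i))
  have hlminmax : lmin ≤ lmax := by
    have h := (hlmin_le ![1, 0, 0]).trans (hlmax_ge ![1, 0, 0])
    simpa [dotProduct, Fin.sum_univ_three] using h
  have hc1' : c1 ^ 2 < ktp * 1 := by
    rw [mul_one]
    exact (Real.lt_sqrt hc1pos.le).mp (lt_min_iff.mp hc1).1
  have hc2' : c2 ^ 2 < krp * lmin := (Real.lt_sqrt hc2pos.le).mp (lt_min_iff.mp hc2).1
  have hk : krp ≤ 2 * krp / (2 - ψ2) := by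
    rw [le_div_iff₀ hψ]
    nlinarith
  have hc2'' : c2 ^ 2 < 2 * krp / (2 - ψ2) * lmax :=
    hc2'.trans_le (mul_le_mul hk hlminmax hlmin.le (hkrp.le.trans hk))
  have hVIp : 0 ≤ VIp :=
    Finset.sum_nonneg fun i _ => integral_mul_sat_sub_nonneg hkpi hσ1 (hΔp i) (epi i)
  have hVIR : 0 ≤ VIR :=
    Finset.sum_nonneg fun i _ => integral_mul_sat_sub_nonneg hkri hσ2 (hΔR i) (eri i)
  refine ⟨?_, fun z hz => dotProduct_half_smul_mulVec_pos hktp (by rwa [neg_sq]) hz,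
    fun z hz => dotProduct_half_smul_mulVec_pos hktp hc1' hz,
    fun z hz => dotProduct_half_smul_mulVec_pos hkrp (by rwa [neg_sq]) hz,
    fun z hz => dotProduct_half_smul_mulVec_pos (hkrp.trans_le hk) hc2'' hz,
    add_nonneg hVIp hVIR, ?_⟩
  · have hp := abs_le.mp (abs_dotProduct_le_norm3_mul ep ev)
    have hr := abs_le.mp (abs_dotProduct_le_norm3_mul eR eω)
    have hp1 := mul_le_mul_of_nonneg_left hp.1 hc1pos.le
    have hp2 := mul_le_mul_of_nonneg_left hp.2 hc1pos.le
    have hr1 := mul_le_mul_of_nonneg_left hr.1 hc2pos.le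
    have hr2 := mul_le_mul_of_nonneg_left hr.2 hc2pos.le
    have hJ1 := hlmin_le eω
    have hJ2 := hlmax_ge eω
    rw [← norm3_sq] at hJ1 hJ2
    have hΨ1 : krp * norm3 eR ^ 2 ≤ 2 * (krp * Ψ) := by
      rw [heR]
      nlinarith [mul_nonneg hkrp.le (sq_nonneg Ψ)]
    have hΨ2 : 2 * (krp * Ψ) ≤ 2 * krp / (2 - ψ2) * norm3 eR ^ 2 := by
      rw [heR, div_mul_eq_mul_div, le_div_iff₀ hψ]
      nlinarith [mul_nonneg (mul_nonneg hkrp.le hΨ0) (sub_nonneg.mpr hΨψ)]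
    simp only [V, V1, V2, VI, M11, M12, M21, M22, dotProduct_half_smul_mulVec]
    simp only [z1, z2, cons_val_zero, cons_val_one]
    constructor <;> linarith
  · rw [← sum_integral_mul_sat_sub_eq_zero_iff hkpi hσ1 hΔp,
      ← sum_integral_mul_sat_sub_eq_zero_iff hkri hσ2 hΔR]
    exact add_eq_zero_iff_of_nonneg hVIp hVIR
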